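/- arXiv:2303.15783 — 3 statements merged into one kernel-verified Lean document; each statement's English description precedes it below -/
import Mathlib

section
/- Every multistep Φ with source s, target t, and exactly n occurrences of rule symbols is permutation equivalent to a reduction from s to t consisting of exactly n single steps (the empty multistep itself when n = 0). -/
universe u

/-- A string rewrite system over alphabet `α`: a type of rules with nonempty
left- and right-hand side strings. -/
structure SRS (α : Type u) where
  Rule : Type u
  lhs : Rule → List α
  rhs : Rule → List α
  lhs_ne : ∀ ρ, lhs ρ ≠ []
  rhs_ne : ∀ ρ, rhs ρ ≠ []

namespace SRS

variable {α : Type u}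

/-- Proof terms over a string rewrite system, indexed by source and target strings. -/
inductive PT (S : SRS α) : List α → List α → Type u
  | eps : PT S [] []
  | letter (a : α) : PT S [a] [a]
  | rule (ρ : S.Rule) : PT S (S.lhs ρ) (S.rhs ρ)
  | hcomp {s₁ t₁ s₂ t₂ : List α} : PT S s₁ t₁ → PT S s₂ t₂ → PT S (s₁ ++ s₂) (t₁ ++ t₂)
  | vcomp {s t u : List α} : PT S s t → PT S t u → PT S s u

namespace PT

variable {S : SRS α}

/-- A string viewed as a proof term. -/
def ofString (S : SRS α) : (s : List α) → PT S s s
  | [] => .eps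
  | a :: s => .hcomp (.letter a) (ofString S s)

/-- The source string of a proof term. -/
def src {s t : List α} (_ : PT S s t) : List α := s

/-- The target string of a proof term. -/
def tgt {s t : List α} (_ : PT S s t) : List α := t

/-- Number of occurrences of rule symbols in a proof term. -/
def ruleCount : {s t : List α} → PT S s t → ℕ
  | _, _, .eps => 0
  | _, _, .letter _ => 0
  | _, _, .rule _ => 1
  | _, _, .hcomp γ δ => ruleCount γ + ruleCount δ
  | _, _, .vcomp γ δ => ruleCount γ + ruleCount δ

/-- A proof term contains no vertical composition (is a multistep). -/
def noVcomp : {s t : List α} → PT S s t → Prop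
  | _, _, .eps => True
  | _, _, .letter _ => True
  | _, _, .rule _ => True
  | _, _, .hcomp γ δ => noVcomp γ ∧ noVcomp δ
  | _, _, .vcomp _ _ => False

/-- An empty multistep: no vertical composition and no rule symbols. -/
def IsEmptyMS {s t : List α} (γ : PT S s t) : Prop := γ.noVcomp ∧ γ.ruleCount = 0

/-- A (single) step: a multistep with exactly one occurrence of a rule symbol. -/
def IsStep {s t : List α} (γ : PT S s t) : Prop := γ.noVcomp ∧ γ.ruleCount = 1

/-- Permutation equivalence: the least congruence containing the horizontal and
vertical monoid laws and the exchange law. -/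
inductive PermEq : ∀ {s t s' t' : List α}, PT S s t → PT S s' t' → Prop
  | refl {s t} (γ : PT S s t) : PermEq γ γ
  | symm {s t s' t'} {γ : PT S s t} {δ : PT S s' t'} : PermEq γ δ → PermEq δ γ
  | trans {s t s' t' s'' t''} {γ : PT S s t} {δ : PT S s' t'} {ζ : PT S s'' t''} :
      PermEq γ δ → PermEq δ ζ → PermEq γ ζ
  | hcongr {s₁ t₁ s₂ t₂ s₁' t₁' s₂' t₂'} {γ : PT S s₁ t₁} {γ' : PT S s₁' t₁'}
      {δ : PT S s₂ t₂} {δ' : PT S s₂' t₂'} :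
      PermEq γ γ' → PermEq δ δ' → PermEq (γ.hcomp δ) (γ'.hcomp δ')
  | vcongr {s t u s' t' u'} {γ : PT S s t} {δ : PT S t u} {γ' : PT S s' t'} {δ' : PT S t' u'} :
      PermEq γ γ' → PermEq δ δ' → PermEq (γ.vcomp δ) (γ'.vcomp δ')
  | hUnitL {s t} (γ : PT S s t) : PermEq (PT.hcomp .eps γ) γ
  | hUnitR {s t} (γ : PT S s t) : PermEq (PT.hcomp γ .eps) γ
  | hAssoc {s₁ t₁ s₂ t₂ s₃ t₃} (γ : PT S s₁ t₁) (δ : PT S s₂ t₂) (ζ : PT S s₃ t₃) :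
      PermEq ((γ.hcomp δ).hcomp ζ) (γ.hcomp (δ.hcomp ζ))
  | vUnitL {s s' t} {σ : PT S s s'} {γ : PT S s' t} :
      IsEmptyMS σ → PermEq (σ.vcomp γ) γ
  | vUnitR {s t t'} {γ : PT S s t} {τ : PT S t t'} :
      IsEmptyMS τ → PermEq (γ.vcomp τ) γ
  | vAssoc {s t u v} (γ : PT S s t) (δ : PT S t u) (ζ : PT S u v) :
      PermEq ((γ.vcomp δ).vcomp ζ) (γ.vcomp (δ.vcomp ζ))
  | exchange {s₁ t₁ u₁ s₂ t₂ u₂} (γ : PT S s₁ t₁) (ζ : PT S t₁ u₁)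
      (δ : PT S s₂ t₂) (η : PT S t₂ u₂) :
      PermEq ((γ.hcomp δ).vcomp (ζ.hcomp η)) ((γ.vcomp ζ).hcomp (δ.vcomp η))

/-- `Resid Φ Ψ Θ` : the multistep `Φ` is contained in the multistep `Ψ`
(obtained from `Ψ` by replacing the non-selected occurrences of rule symbols by
their source strings), with residual `Θ = Ψ/Φ` (obtained from `Ψ` by replacing
the selected occurrences of rule symbols by their target strings). -/
inductive Resid : ∀ {s t u : List α}, PT S s t → PT S s u → PT S t u → Prop
  | eps : Resid .eps .eps .eps
  | letter (a : α) : Resid (.letter a) (.letter a) (.letter a)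
  | ruleKept (ρ : S.Rule) : Resid (.rule ρ) (.rule ρ) (ofString S (S.rhs ρ))
  | ruleSkipped (ρ : S.Rule) : Resid (ofString S (S.lhs ρ)) (.rule ρ) (.rule ρ)
  | hcomp {s₁ t₁ u₁ s₂ t₂ u₂} {Φ₁ : PT S s₁ t₁} {Ψ₁ : PT S s₁ u₁} {Θ₁ : PT S t₁ u₁}
      {Φ₂ : PT S s₂ t₂} {Ψ₂ : PT S s₂ u₂} {Θ₂ : PT S t₂ u₂} :
      Resid Φ₁ Ψ₁ Θ₁ → Resid Φ₂ Ψ₂ Θ₂ → Resid (Φ₁.hcomp Φ₂) (Ψ₁.hcomp Ψ₂) (Θ₁.hcomp Θ₂)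

/-- Containment `Φ ⊆ Ψ` of multisteps with the same source. -/
def Contained {s t u : List α} (Φ : PT S s t) (Ψ : PT S s u) : Prop := ∃ Θ, Resid Φ Ψ Θ

/-- A pair of consecutive multisteps `Φ·Ψ` is loath if there is a multistep `X`
co-initial with `Φ` such that `Φ ⊆ X` and the residual `ψ := X/Φ` is a single
step with `ψ ⊆ Ψ`. -/
def Loath {s t u : List α} (Φ : PT S s t) (Ψ : PT S t u) : Prop :=
  ∃ (v : List α) (X : PT S s v) (ψ : PT S t v),
    X.noVcomp ∧ Resid Φ X ψ ∧ IsStep ψ ∧ ∃ Θ : PT S v u, Resid ψ Ψ Θ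

/-- Right-associated vertical composition of single steps. -/
inductive IsStepSeq : ∀ {s t : List α}, PT S s t → Prop
  | single {s t} {φ : PT S s t} : IsStep φ → IsStepSeq φ
  | cons {s t u} {φ : PT S s t} {γ : PT S t u} : IsStep φ → IsStepSeq γ → IsStepSeq (φ.vcomp γ)

/-- A reduction: an empty multistep or a right-associated composition of steps. -/
def IsRed {s t : List α} (γ : PT S s t) : Prop := IsEmptyMS γ ∨ IsStepSeq γ

/-- Right-associated vertical composition of nonempty multisteps. -/
inductive IsMSSeq : ∀ {s t : List α}, PT S s t → Prop
  | single {s t} {Φ : PT S s t} : Φ.noVcomp → Φ.ruleCount ≠ 0 → IsMSSeq Φ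
  | cons {s t u} {Φ : PT S s t} {γ : PT S t u} :
      Φ.noVcomp → Φ.ruleCount ≠ 0 → IsMSSeq γ → IsMSSeq (Φ.vcomp γ)

/-- A multistep reduction: an empty multistep or a right-associated vertical
composition of nonempty multisteps. -/
def IsMSRed {s t : List α} (γ : PT S s t) : Prop := IsEmptyMS γ ∨ IsMSSeq γ

/-- `FirstMS γ Φ` : `Φ` is the first multistep of the multistep reduction `γ`. -/
inductive FirstMS : ∀ {s t v : List α}, PT S s t → PT S s v → Prop
  | base {s t} {Φ : PT S s t} : Φ.noVcomp → FirstMS Φ Φ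
  | cons {s t u} {Φ : PT S s t} {γ : PT S t u} : Φ.noVcomp → FirstMS (Φ.vcomp γ) Φ

/-- No pair of consecutive multisteps is loath. -/
inductive NoLoathPairs : ∀ {s t : List α}, PT S s t → Prop
  | base {s t} {γ : PT S s t} : γ.noVcomp → NoLoathPairs γ
  | cons {s t u} {Φ : PT S s t} {γ : PT S t u} : Φ.noVcomp → NoLoathPairs γ →
      (∀ {v : List α} (Ψ : PT S t v), FirstMS γ Ψ → ¬ Loath Φ Ψ) → NoLoathPairs (Φ.vcomp γ)

/-- A greedy multistep reduction. -/
def IsGreedyMSR {s t : List α} (γ : PT S s t) : Prop := IsMSRed γ ∧ NoLoathPairs γ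

/-- Swapping a loath pair of consecutive multisteps, anywhere within a
(right-associated) multistep reduction: a loath pair `Φ·Ψ` with witness `X`
(where `ψ := X/Φ` is a step with `ψ ⊆ Ψ`) is replaced by `X·(Ψ/ψ)`. -/
inductive Swap : ∀ {s t : List α}, PT S s t → PT S s t → Prop
  | head {s t u v} {Φ : PT S s t} {Ψ : PT S t u} {X : PT S s v} {ψ : PT S t v} {Θ : PT S v u} :
      X.noVcomp → Resid Φ X ψ → IsStep ψ → Resid ψ Ψ Θ → Swap (Φ.vcomp Ψ) (X.vcomp Θ)
  | headCons {s t u w v} {Φ : PT S s t} {Ψ : PT S t u} {γ : PT S u w} {X : PT S s v}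
      {ψ : PT S t v} {Θ : PT S v u} :
      X.noVcomp → Resid Φ X ψ → IsStep ψ → Resid ψ Ψ Θ →
      Swap (Φ.vcomp (Ψ.vcomp γ)) (X.vcomp (Θ.vcomp γ))
  | tail {s t u} {Φ : PT S s t} {γ γ' : PT S t u} :
      Φ.noVcomp → Swap γ γ' → Swap (Φ.vcomp γ) (Φ.vcomp γ')

/-- Removal of a trailing empty multistep. -/
inductive Drop : ∀ {s t : List α}, PT S s t → PT S s t → Prop
  | drop {s t} {Φ : PT S s t} {e : PT S t t} : IsEmptyMS e → Drop (Φ.vcomp e) Φ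
  | tail {s t u} {Φ : PT S s t} {γ γ' : PT S t u} : Drop γ γ' → Drop (Φ.vcomp γ) (Φ.vcomp γ')

/-- Swapping together with removal of trailing empty multisteps. -/
def SwapD {s t : List α} (γ δ : PT S s t) : Prop := Swap γ δ ∨ Drop γ δ

/-- The list of numbers of rule symbols of the constituent multisteps of a
(right-associated) multistep reduction, head first.  Its reverse, compared
lexicographically, is the Sekar–Ramakrishnan measure. -/
def msList : {s t : List α} → PT S s t → List ℕ
  | _, _, .vcomp Φ γ => ruleCount Φ :: msList γ
  | _, _, γ => [ruleCount γ]

/-- The rule occurrences of a multistep, with the starting position of the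
interval of letter positions each occupies in the source string. -/
def srcOccs : {s t : List α} → PT S s t → List (ℕ × S.Rule)
  | _, _, .eps => []
  | _, _, .letter _ => []
  | _, _, .rule ρ => [(0, ρ)]
  | _, _, @PT.hcomp _ _ s₁ _ _ _ γ δ =>
      srcOccs γ ++ (srcOccs δ).map (fun p => (s₁.length + p.1, p.2))
  | _, _, .vcomp _ _ => []

/-- The rule occurrences of a multistep, with the starting position of the
interval of letter positions each occupies in the target string. -/
def tgtOccs : {s t : List α} → PT S s t → List (ℕ × S.Rule)
  | _, _, .eps => []
  | _, _, .letter _ => []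
  | _, _, .rule ρ => [(0, ρ)]
  | _, _, @PT.hcomp _ _ _ t₁ _ _ γ δ =>
      tgtOccs γ ++ (tgtOccs δ).map (fun p => (t₁.length + p.1, p.2))
  | _, _, .vcomp _ _ => []

end PT

/-- A single rewrite step on strings: replacing an occurrence of the left-hand
side of a rule by its right-hand side. -/
def StrStep (S : SRS α) (x y : List α) : Prop :=
  ∃ (u v : List α) (ρ : S.Rule), x = u ++ S.lhs ρ ++ v ∧ y = u ++ S.rhs ρ ++ v

end SRS

namespace SRS.PT

variable {α : Type u} {S : SRS α}

theorem ofString_isEmptyMS (s : List α) : IsEmptyMS (ofString S s) := by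
  induction s with
  | nil => exact ⟨trivial, rfl⟩
  | cons a s ih => exact ⟨⟨trivial, ih.1⟩, by simp [ofString, ruleCount, ih.2]⟩

/-- An empty multistep has equal source and target. -/
theorem IsEmptyMS.src_eq_tgt {s t : List α} {γ : PT S s t} (h : IsEmptyMS γ) : s = t := by
  induction γ with
  | eps => rfl
  | letter a => rfl
  | rule ρ => exact absurd h.2 one_ne_zero
  | hcomp γ δ ihγ ihδ =>
    obtain ⟨⟨hγ, hδ⟩, hc⟩ := h
    obtain ⟨cγ, cδ⟩ := Nat.add_eq_zero_iff.mp hc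
    rw [ihγ ⟨hγ, cγ⟩, ihδ ⟨hδ, cδ⟩]
  | vcomp γ δ => exact h.1.elim

theorem IsEmptyMS.hcomp {s₁ t₁ s₂ t₂ : List α} {γ : PT S s₁ t₁} {δ : PT S s₂ t₂}
    (hγ : IsEmptyMS γ) (hδ : IsEmptyMS δ) : IsEmptyMS (γ.hcomp δ) :=
  ⟨⟨hγ.1, hδ.1⟩, by simp [ruleCount, hγ.2, hδ.2]⟩

/-- The sequentialization of a horizontal composition: first the left, then the right factor. -/
theorem PermEq.hcomp_sequentialize {s₁ t₁ s₂ t₂ : List α} (γ : PT S s₁ t₁) (δ : PT S s₂ t₂) :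
    PermEq (γ.hcomp δ)
      ((γ.hcomp (ofString S s₂)).vcomp ((ofString S t₁).hcomp δ)) :=
  .trans
    (.hcongr (.symm (.vUnitR (ofString_isEmptyMS t₁))) (.symm (.vUnitL (ofString_isEmptyMS s₂))))
    (.symm (.exchange _ _ _ _))

/-- Step sequences are closed, up to permutation equivalence, under whiskering on the right. -/
theorem IsStepSeq.hcomp_empty {s t u : List α} {γ : PT S s t} (h : IsStepSeq γ)
    {e : PT S u u} (he : IsEmptyMS e) :
    ∃ γ' : PT S (s ++ u) (t ++ u),
      IsStepSeq γ' ∧ γ'.ruleCount = γ.ruleCount ∧ PermEq (γ.hcomp e) γ' := by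
  induction h with
  | @single s t φ hφ =>
    have hc : (φ.hcomp e).ruleCount = φ.ruleCount := by simp [ruleCount, he.2]
    exact ⟨φ.hcomp e, .single ⟨⟨hφ.1, he.1⟩, hc.trans hφ.2⟩, hc, .refl _⟩
  | @cons s t v φ γ hφ _ ih =>
    obtain ⟨γ', hγ', hc, hp⟩ := ih
    have hcφ : (φ.hcomp e).ruleCount = φ.ruleCount := by simp [ruleCount, he.2]
    exact ⟨(φ.hcomp e).vcomp γ', .cons ⟨⟨hφ.1, he.1⟩, hcφ.trans hφ.2⟩ hγ',
      congrArg₂ (· + ·) hcφ hc,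
      .trans (.hcongr (.refl _) (.symm (.vUnitL he)))
        (.trans (.symm (.exchange _ _ _ _)) (.vcongr (.refl _) hp))⟩

/-- Step sequences are closed, up to permutation equivalence, under whiskering on the left. -/
theorem IsStepSeq.empty_hcomp {s t u : List α} {γ : PT S s t} (h : IsStepSeq γ)
    {e : PT S u u} (he : IsEmptyMS e) :
    ∃ γ' : PT S (u ++ s) (u ++ t),
      IsStepSeq γ' ∧ γ'.ruleCount = γ.ruleCount ∧ PermEq (e.hcomp γ) γ' := by
  induction h with
  | @single s t φ hφ =>
    have hc : (e.hcomp φ).ruleCount = φ.ruleCount := by simp [ruleCount, he.2]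
    exact ⟨e.hcomp φ, .single ⟨⟨he.1, hφ.1⟩, hc.trans hφ.2⟩, hc, .refl _⟩
  | @cons s t v φ γ hφ _ ih =>
    obtain ⟨γ', hγ', hc, hp⟩ := ih
    have hcφ : (e.hcomp φ).ruleCount = φ.ruleCount := by simp [ruleCount, he.2]
    exact ⟨(e.hcomp φ).vcomp γ', .cons ⟨⟨he.1, hφ.1⟩, hcφ.trans hφ.2⟩ hγ',
      congrArg₂ (· + ·) hcφ hc,
      .trans (.hcongr (.symm (.vUnitL he)) (.refl _))
        (.trans (.symm (.exchange _ _ _ _)) (.vcongr (.refl _) hp))⟩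

/-- Step sequences are closed, up to permutation equivalence, under vertical composition. -/
theorem IsStepSeq.vcomp {s t u : List α} {γ : PT S s t} {δ : PT S t u} (hγ : IsStepSeq γ)
    (hδ : IsStepSeq δ) :
    ∃ ζ : PT S s u,
      IsStepSeq ζ ∧ ζ.ruleCount = γ.ruleCount + δ.ruleCount ∧ PermEq (γ.vcomp δ) ζ := by
  induction hγ with
  | single hφ => exact ⟨_, .cons hφ hδ, rfl, .refl _⟩
  | @cons s t v φ γ hφ _ ih =>
    obtain ⟨ζ, hζ, hc, hp⟩ := ih hδ
    exact ⟨φ.vcomp ζ, .cons hφ hζ, by simp only [ruleCount, hc, Nat.add_assoc],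
      .trans (.vAssoc _ _ _) (.vcongr (.refl _) hp)⟩

/-- Reductions are closed, up to permutation equivalence, under horizontal composition. -/
theorem IsRed.hcomp {s₁ t₁ s₂ t₂ : List α} {γ : PT S s₁ t₁} {δ : PT S s₂ t₂}
    (hγ : IsRed γ) (hδ : IsRed δ) :
    ∃ ζ : PT S (s₁ ++ s₂) (t₁ ++ t₂),
      IsRed ζ ∧ ζ.ruleCount = γ.ruleCount + δ.ruleCount ∧ PermEq (γ.hcomp δ) ζ := by
  rcases hγ with hγ | hγ <;> rcases hδ with hδ | hδ
  · exact ⟨_, .inl (hγ.hcomp hδ), rfl, .refl _⟩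
  · obtain rfl := hγ.src_eq_tgt
    obtain ⟨ζ, hζ, hc, hp⟩ := hδ.empty_hcomp hγ
    exact ⟨ζ, .inr hζ, by rw [hc, hγ.2, Nat.zero_add], hp⟩
  · obtain rfl := hδ.src_eq_tgt
    obtain ⟨ζ, hζ, hc, hp⟩ := hγ.hcomp_empty hδ
    exact ⟨ζ, .inr hζ, by rw [hc, hδ.2, Nat.add_zero], hp⟩
  · obtain ⟨γ', hγ', hcγ, hpγ⟩ := hγ.hcomp_empty (ofString_isEmptyMS s₂)
    obtain ⟨δ', hδ', hcδ, hpδ⟩ := hδ.empty_hcomp (ofString_isEmptyMS t₁)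
    obtain ⟨ζ, hζ, hc, hp⟩ := hγ'.vcomp hδ'
    exact ⟨ζ, .inr hζ, by rw [hc, hcγ, hcδ],
      .trans (.hcomp_sequentialize γ δ) (.trans (.vcongr hpγ hpδ) hp)⟩

end SRS.PT

open SRS.PT in
/-- A multistep with exactly `n` rule symbols is permutation equivalent to a
reduction (with the same source and target) consisting of exactly `n` steps. -/
theorem statement3 {α : Type u} {S : SRS α} {s t : List α} (Φ : SRS.PT S s t) (n : ℕ)
    (hms : Φ.noVcomp) (hn : Φ.ruleCount = n) :
    ∃ γ' : SRS.PT S s t, IsRed γ' ∧ γ'.ruleCount = n ∧ PermEq Φ γ' := by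
  induction Φ generalizing n with
  | eps => exact ⟨.eps, .inl ⟨trivial, rfl⟩, hn, .refl _⟩
  | letter a => exact ⟨.letter a, .inl ⟨trivial, rfl⟩, hn, .refl _⟩
  | rule ρ => exact ⟨.rule ρ, .inr (.single ⟨trivial, rfl⟩), hn, .refl _⟩
  | hcomp Φ Ψ ihΦ ihΨ =>
    obtain ⟨γ, hγ, hcγ, hpγ⟩ := ihΦ _ hms.1 rfl
    obtain ⟨δ, hδ, hcδ, hpδ⟩ := ihΨ _ hms.2 rfl
    obtain ⟨ζ, hζ, hc, hp⟩ := hγ.hcomp hδ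
    exact ⟨ζ, hζ, by rw [hc, hcγ, hcδ]; exact hn, .trans (.hcongr hpγ hpδ) hp⟩
  | vcomp Φ Ψ => exact hms.elim
end

section
/- If Φ and Ψ are multisteps with the same source and Φ ⊆ Ψ, then Ψ is permutation equivalent to the vertical composition Φ·(Ψ/Φ) of Φ followed by the residual of Ψ after Φ. -/
universe u

namespace SRS.PT

theorem isEmptyMS_ofString {α : Type u} (S : SRS α) (s : List α) :
    IsEmptyMS (ofString S s) := by
  induction s with
  | nil => exact ⟨trivial, rfl⟩
  | cons a s ih => exact ⟨⟨trivial, ih.1⟩, by simp [ofString, ruleCount, ih.2]⟩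

theorem isEmptyMS_eps {α : Type u} (S : SRS α) : IsEmptyMS (.eps : PT S [] []) :=
  isEmptyMS_ofString S []

theorem isEmptyMS_letter {α : Type u} (S : SRS α) (a : α) :
    IsEmptyMS (.letter a : PT S [a] [a]) := by
  simp [IsEmptyMS, noVcomp, ruleCount]

end SRS.PT

open SRS.PT in
/-- If `Φ ⊆ Ψ` then `Ψ` is permutation equivalent to `Φ·(Ψ/Φ)`. -/
theorem statement5 {α : Type u} {S : SRS α} {s t u : List α}
    {Φ : SRS.PT S s t} {Ψ : SRS.PT S s u} {Θ : SRS.PT S t u}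
    (h : Resid Φ Ψ Θ) :
    PermEq Ψ (Φ.vcomp Θ) := by
  induction h with
  | eps => exact (PermEq.vUnitL (isEmptyMS_eps S)).symm
  | letter a => exact (PermEq.vUnitL (isEmptyMS_letter S a)).symm
  | ruleKept ρ => exact (PermEq.vUnitR (isEmptyMS_ofString S _)).symm
  | ruleSkipped ρ => exact (PermEq.vUnitL (isEmptyMS_ofString S _)).symm
  | hcomp _ _ ih₁ ih₂ => exact (PermEq.hcongr ih₁ ih₂).trans (PermEq.exchange _ _ _ _).symm
end

section
/- Each swap applied within a multistep reduction strictly decreases the Sekar–Ramakrishnan measure, which assigns to a multistep reduction Φ₁·…·Φₖ the tuple of numbers of rule symbols of its constituent multisteps compared lexicographically from tail to head (later positions more significant); consequently the swapping relation on multistep reductions is terminating: there is no infinite sequence of successive swaps. -/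
universe u

namespace SRS.PT

variable {α : Type u} {S : SRS α}

theorem ruleCount_ofString (s : List α) : (ofString S s).ruleCount = 0 := by
  induction s with
  | nil => rfl
  | cons a s ih => simp [ofString, ruleCount, ih]

theorem noVcomp_ofString (s : List α) : (ofString S s).noVcomp := by
  induction s with
  | nil => trivial
  | cons a s ih => exact ⟨trivial, ih⟩

theorem msList_of_noVcomp {s t : List α} {γ : PT S s t} (h : γ.noVcomp) :
    msList γ = [ruleCount γ] := by
  cases γ with
  | vcomp => exact h.elim
  | _ => rfl

namespace Resid

variable {s t u : List α} {Φ : PT S s t} {Ψ : PT S s u} {Θ : PT S t u}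

theorem ruleCount_eq (h : Resid Φ Ψ Θ) : Ψ.ruleCount = Φ.ruleCount + Θ.ruleCount := by
  induction h with
  | hcomp _ _ ih₁ ih₂ => simp only [ruleCount, ih₁, ih₂]; omega
  | _ => simp [ruleCount, ruleCount_ofString]

theorem noVcomp_right (h : Resid Φ Ψ Θ) : Ψ.noVcomp := by
  induction h with
  | hcomp _ _ ih₁ ih₂ => exact ⟨ih₁, ih₂⟩
  | _ => trivial

theorem noVcomp_residual (h : Resid Φ Ψ Θ) : Θ.noVcomp := by
  induction h with
  | hcomp _ _ ih₁ ih₂ => exact ⟨ih₁, ih₂⟩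
  | ruleKept => exact noVcomp_ofString _
  | _ => trivial

end Resid

/-- A swap increments one entry of the list of rule counts and decrements the next one. -/
theorem Swap.msList_eq {s t : List α} {γ γ' : PT S s t} (h : Swap γ γ') :
    ∃ (l r : List ℕ) (m n : ℕ),
      msList γ = l ++ m :: (n + 1) :: r ∧ msList γ' = l ++ (m + 1) :: n :: r := by
  induction h with
  | @head _ _ _ _ Φ Ψ X ψ Θ _ hX hψ hΘ =>
    refine ⟨[], [], Φ.ruleCount, Θ.ruleCount, ?_, ?_⟩
    · simp [msList, msList_of_noVcomp hΘ.noVcomp_right, hΘ.ruleCount_eq, hψ.2, Nat.add_comm]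
    · simp [msList, msList_of_noVcomp hΘ.noVcomp_residual, hX.ruleCount_eq, hψ.2]
  | @headCons _ _ _ _ _ Φ Ψ γ X ψ Θ _ hX hψ hΘ =>
    refine ⟨[], msList γ, Φ.ruleCount, Θ.ruleCount, ?_, ?_⟩
    · simp [msList, hΘ.ruleCount_eq, hψ.2, Nat.add_comm]
    · simp [msList, hX.ruleCount_eq, hψ.2]
  | @tail _ _ _ Φ _ _ _ _ ih =>
    obtain ⟨l, r, m, n, h₁, h₂⟩ := ih
    exact ⟨Φ.ruleCount :: l, r, m, n, by simp [msList, h₁], by simp [msList, h₂]⟩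

theorem Swap.length_msList_eq {s t : List α} {γ γ' : PT S s t} (h : Swap γ γ') :
    (msList γ').length = (msList γ).length := by
  obtain ⟨l, r, m, n, h₁, h₂⟩ := h.msList_eq
  simp [h₁, h₂]

theorem Swap.lex_reverse_msList {s t : List α} {γ γ' : PT S s t} (h : Swap γ γ') :
    List.Lex (· < ·) (msList γ').reverse (msList γ).reverse := by
  obtain ⟨l, r, m, n, h₁, h₂⟩ := h.msList_eq
  simpa [h₁, h₂] using List.Lex.append_left (· < ·) (List.Lex.rel (Nat.lt_succ_self n)) r.reverse

theorem wellFounded_swap (s t : List α) :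
    WellFounded fun γ' γ : PT S s t => Swap γ γ' := by
  refine Subrelation.wf (r := InvImage (List.Shortlex (· < ·)) fun γ => (msList γ).reverse) ?_
    (InvImage.wf _ (List.Shortlex.wf Nat.lt_wfRel.wf))
  intro γ' γ h
  exact List.Shortlex.of_lex (by simpa using h.length_msList_eq) h.lex_reverse_msList

end SRS.PT

open SRS.PT in
/-- Each swap applied within a multistep reduction strictly decreases the
Sekar–Ramakrishnan measure (the tuple of rule counts compared lexicographically
from tail to head); consequently swapping on multistep reductions terminates. -/
theorem statement7 {α : Type u} {S : SRS α} :
    (∀ (s t : List α) (γ γ' : SRS.PT S s t), IsMSRed γ → Swap γ γ' →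
        List.Lex (· < ·) (msList γ').reverse (msList γ).reverse) ∧
    (∀ (s t : List α) (f : ℕ → SRS.PT S s t), IsMSRed (f 0) →
        ¬ ∀ n, Swap (f n) (f (n + 1))) := by
  refine ⟨fun _ _ _ _ _ h => h.lex_reverse_msList, fun s t f _ hf => ?_⟩
  exact (wellFounded_iff_isEmpty_descending_chain.mp (wellFounded_swap s t)).false ⟨f, hf⟩
end
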